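/- Let B be a λ-partition of V_n for some λ > 0, and let (σ_t), (σ̃_t) be two cyclic dynamics with p = 1/2 whose proportion vectors coincide, S_0 = S̃_0, and whose basket chains satisfy 𝐒_0, 𝐒̃_0 ∈ 𝕊^{r/√n} for some constant r > 0. Then for every ε > 0 there exists a sufficiently large γ > 0 such that, for all sufficiently large n, there is a Markovian coupling (the basketwise coupling) of the two dynamics under which ℙ^{BC}_{σ_0, σ̃_0}( 𝐒_{⌈γn⌉} = 𝐒̃_{⌈γn⌉} ) ≥ 1 − ε. -/

import Mathlib

open Finset
open scoped Classical

/-- Configuration space `Σ_n = {1,2,3}^{V_n}`, colors encoded as `Fin 3`. -/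
abbrev Config (n : ℕ) := Fin n → Fin 3

/-- Transition matrix of the cyclic dynamics with parameter `p` on `Σ_n`. -/
noncomputable def cyclicP (n : ℕ) (p : ℝ) : Matrix (Config n) (Config n) ℝ :=
  Matrix.of fun σ τ => (1 / (n : ℝ)) * ∑ v : Fin n,
    ((1 - p) * (if τ = σ then (1 : ℝ) else 0)
      + p * (if τ = Function.update σ v (σ v + 1) then (1 : ℝ) else 0))

/-- Proportion vector `S(σ) ∈ ℝ³`. -/
noncomputable def propVec {n : ℕ} (σ : Config n) : Fin 3 → ℝ :=
  fun k => ((univ.filter fun v => σ v = k).card : ℝ) / n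

/-- `B` is a 3-partition of `V_n` into baskets. -/
def IsPartition {n : ℕ} (B : Fin 3 → Finset (Fin n)) : Prop :=
  (∀ m m' : Fin 3, m ≠ m' → Disjoint (B m) (B m')) ∧ (∀ v : Fin n, ∃ m, v ∈ B m)

/-- Basket-chain matrix `𝐒(σ)^{m,k}`: the proportion of color-`k` vertices within
basket `B_m`. -/
noncomputable def basketS {n : ℕ} (B : Fin 3 → Finset (Fin n)) (σ : Config n)
    (m k : Fin 3) : ℝ :=
  (((B m).filter fun v => σ v = k).card : ℝ) / (B m).card

/-- Membership in `S^ρ`: a point of the probability simplex in `ℝ³` with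
`‖s − ē‖_∞ < ρ`. -/
def inS (ρ : ℝ) (s : Fin 3 → ℝ) : Prop :=
  (∀ k, 0 ≤ s k) ∧ (∑ k, s k) = 1 ∧ (∀ k, |s k - 1/3| < ρ)

/-- Membership in `𝕊^ρ`: every row of the `3×3` matrix lies in `S^ρ`. -/
def inSmat (ρ : ℝ) (M : Fin 3 → Fin 3 → ℝ) : Prop := ∀ m, inS ρ (M m)

/-- A Markovian coupling of two copies of the cyclic dynamics: a transition matrix on
`Σ_n × Σ_n` with nonnegative entries whose marginal transitions are both `cyclicP n p`. -/
def IsCoupling (n : ℕ) (p : ℝ) (K : Matrix (Config n × Config n) (Config n × Config n) ℝ) : Prop :=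
  (∀ x y, 0 ≤ K x y) ∧
  (∀ x : Config n × Config n, ∀ τ : Config n,
      ∑ τ' : Config n, K x (τ, τ') = cyclicP n p x.1 τ) ∧
  (∀ x : Config n × Config n, ∀ τ' : Config n,
      ∑ τ : Config n, K x (τ, τ') = cyclicP n p x.2 τ')

/-- One rotation of the colour of the vertex `v`. -/
def bump {n : ℕ} (σ : Config n) (v : Fin n) : Config n := Function.update σ v (σ v + 1)

/-- Number of vertices of colour `k` in `A`, as an integer. -/
def colorCount {n : ℕ} (A : Finset (Fin n)) (σ : Config n) (k : Fin 3) : ℤ :=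
  ((A.filter fun v => σ v = k).card : ℤ)

/-- Difference of the colour counts of two configurations in `A`. -/
def gap {n : ℕ} (A : Finset (Fin n)) (x : Config n × Config n) (k : Fin 3) : ℤ :=
  colorCount A x.1 k - colorCount A x.2 k

/-- The effect on a vector of colour counts of one rotation of a vertex of colour `i`. -/
def rotate (d : Fin 3 → ℤ) (i k : Fin 3) : ℤ :=
  d k - (if i = k then 1 else 0) + (if i + 1 = k then 1 else 0)

/-- The effect on a vector of colour counts of undoing one rotation of a vertex of colour `i`. -/
def unrotate (d : Fin 3 → ℤ) (i k : Fin 3) : ℤ :=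
  d k + (if i = k then 1 else 0) - (if i + 1 = k then 1 else 0)

/-- Total positive part of an integer vector. -/
def excess (d : Fin 3 → ℤ) : ℤ := ∑ k, max (d k) 0

lemma colorCount_eq_sum {n : ℕ} (A : Finset (Fin n)) (σ : Config n) (k : Fin 3) :
    colorCount A σ k = ∑ v ∈ A, if σ v = k then 1 else 0 := by
  simp [colorCount, Finset.sum_boole]

lemma colorCount_nonneg {n : ℕ} (A : Finset (Fin n)) (σ : Config n) (k : Fin 3) :
    0 ≤ colorCount A σ k := by simp [colorCount]

lemma sum_colorCount {n : ℕ} (A : Finset (Fin n)) (σ : Config n) :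
    ∑ k, colorCount A σ k = A.card := by
  simp only [colorCount_eq_sum]
  rw [Finset.sum_comm]
  simp

lemma sum_gap {n : ℕ} (A : Finset (Fin n)) (x : Config n × Config n) : ∑ k, gap A x k = 0 := by
  simp [gap, Finset.sum_sub_distrib, sum_colorCount]

lemma colorCount_bump_of_mem {n : ℕ} {A : Finset (Fin n)} (σ : Config n) {v : Fin n}
    (hv : v ∈ A) (k : Fin 3) : colorCount A (bump σ v) k = rotate (colorCount A σ) (σ v) k := by
  rw [rotate, colorCount_eq_sum, colorCount_eq_sum, ← Finset.add_sum_erase _ _ hv,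
    ← Finset.add_sum_erase _ _ hv]
  have : ∑ w ∈ A.erase v, (if bump σ v w = k then (1 : ℤ) else 0)
      = ∑ w ∈ A.erase v, if σ w = k then (1 : ℤ) else 0 := by
    refine Finset.sum_congr rfl fun w hw => ?_
    rw [bump, Function.update_of_ne (Finset.ne_of_mem_erase hw)]
  rw [this, bump, Function.update_self]
  ring

lemma colorCount_bump_of_notMem {n : ℕ} {A : Finset (Fin n)} (σ : Config n) {v : Fin n}
    (hv : v ∉ A) : colorCount A (bump σ v) = colorCount A σ := by
  funext k
  rw [colorCount_eq_sum, colorCount_eq_sum]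
  refine Finset.sum_congr rfl fun w hw => ?_
  have hwv : w ≠ v := fun h => hv (h ▸ hw)
  rw [bump, Function.update_of_ne hwv]

lemma gap_bump_left {n : ℕ} {A : Finset (Fin n)} (x : Config n × Config n) {v : Fin n}
    (hv : v ∈ A) : gap A (bump x.1 v, x.2) = rotate (gap A x) (x.1 v) := by
  funext k
  simp only [gap, colorCount_bump_of_mem x.1 hv, rotate]
  ring

lemma gap_bump_right {n : ℕ} {A : Finset (Fin n)} (x : Config n × Config n) {v : Fin n}
    (hv : v ∈ A) : gap A (x.1, bump x.2 v) = unrotate (gap A x) (x.2 v) := by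
  funext k
  simp only [gap, colorCount_bump_of_mem x.2 hv, rotate, unrotate]
  ring

lemma gap_bump_both {n : ℕ} {A : Finset (Fin n)} (x : Config n × Config n) {v w : Fin n}
    (hv : v ∈ A) (hw : w ∈ A) (h : x.1 v = x.2 w) :
    gap A (bump x.1 v, bump x.2 w) = gap A x := by
  funext k
  simp only [gap, colorCount_bump_of_mem x.1 hv, colorCount_bump_of_mem x.2 hw, rotate, h]
  ring

lemma excess_nonneg (d : Fin 3 → ℤ) : 0 ≤ excess d :=
  Finset.sum_nonneg fun _ _ => le_max_right _ _

lemma eq_zero_of_excess_eq_zero {d : Fin 3 → ℤ} (hd : ∑ k, d k = 0) (h : excess d = 0) :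
    d = 0 := by
  simp only [excess, Fin.sum_univ_three] at hd h
  funext k
  fin_cases k <;> simp <;> omega

lemma excess_rotate_of_pos_neg {d : Fin 3 → ℤ} {i : Fin 3} (h : 0 < d i) (h' : d (i + 1) < 0) :
    excess (rotate d i) = excess d - 1 ∧ excess (unrotate d i) = excess d + 1 := by
  fin_cases i <;> simp [excess, Fin.sum_univ_three, rotate, unrotate] at * <;> omega

lemma excess_rotate_of_neg_pos {d : Fin 3 → ℤ} {i : Fin 3} (h : d i < 0) (h' : 0 < d (i + 1)) :
    excess (rotate d i) = excess d + 1 ∧ excess (unrotate d i) = excess d - 1 := by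
  fin_cases i <;> simp [excess, Fin.sum_univ_three, rotate, unrotate] at * <;> omega

lemma excess_rotate_of_pos_nonneg {d : Fin 3 → ℤ} {i : Fin 3} (h : 0 < d i)
    (h' : 0 ≤ d (i + 1)) : excess (rotate d i) = excess d := by
  fin_cases i <;> simp [excess, Fin.sum_univ_three, rotate] at * <;> omega

lemma excess_unrotate_of_neg_nonpos {d : Fin 3 → ℤ} {i : Fin 3} (h : d i < 0)
    (h' : d (i + 1) ≤ 0) : excess (unrotate d i) = excess d := by
  fin_cases i <;> simp [excess, Fin.sum_univ_three, unrotate] at * <;> omega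

lemma exists_mul_succ_neg {d : Fin 3 → ℤ} (hd : ∑ k, d k = 0) (h : excess d ≠ 0) :
    ∃ i, d i * d (i + 1) < 0 := by
  by_contra! hc
  have h0 := hc 0
  have h1 := hc 1
  have h2 := hc 2
  simp only [excess, Fin.sum_univ_three] at hd h
  simp only [zero_add, Fin.reduceAdd] at h0 h1 h2
  rcases lt_trichotomy (d 0) 0 with a | a | a <;> rcases lt_trichotomy (d 1) 0 with b | b | b <;>
    rcases lt_trichotomy (d 2) 0 with c | c | c <;> first | omega | nlinarith

/-- A permutation that respects the baskets and pairs equal colours as often as possible. -/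
structure IsMatching {n : ℕ} (B : Fin 3 → Finset (Fin n)) (x : Config n × Config n)
    (π : Equiv.Perm (Fin n)) : Prop where
  mem_iff : ∀ v m, π v ∈ B m ↔ v ∈ B m
  maximal : ∀ m, ∀ v ∈ B m, ∀ w ∈ B m, x.1 v ≠ x.2 (π v) → x.1 w ≠ x.2 (π w) → x.1 v ≠ x.2 (π w)

lemma exists_isMatching {n : ℕ} {B : Fin 3 → Finset (Fin n)} (hB : IsPartition B)
    (x : Config n × Config n) : ∃ π, IsMatching B x π := by
  obtain ⟨π, hπ, hmax⟩ := Finset.exists_max_image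
    (univ.filter fun π : Equiv.Perm (Fin n) => ∀ v m, π v ∈ B m ↔ v ∈ B m)
    (fun π => (univ.filter fun v => x.1 v = x.2 (π v)).card) ⟨1, by simp⟩
  simp only [Finset.mem_filter, Finset.mem_univ, true_and] at hπ hmax
  refine ⟨π, hπ, fun m v hv w hw hvu hwu hvw => ?_⟩
  have hsame : ∀ k, v ∈ B k ↔ w ∈ B k := fun k => by
    rcases eq_or_ne k m with rfl | hk
    · simp [hv, hw]
    · have hd := hB.1 k m hk
      exact ⟨fun h => (Finset.disjoint_left.1 hd h hv).elim,
        fun h => (Finset.disjoint_left.1 hd h hw).elim⟩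
  have hle := hmax (Equiv.swap v w |>.trans π) fun z k => by
    rw [Equiv.trans_apply, hπ]
    by_cases hzv : z = v
    · rw [hzv, Equiv.swap_apply_left, hsame]
    by_cases hzw : z = w
    · rw [hzw, Equiv.swap_apply_right, hsame]
    rw [Equiv.swap_apply_of_ne_of_ne hzv hzw]
  refine absurd hle (not_le.2 (Finset.card_lt_card ?_))
  refine (Finset.ssubset_iff_of_subset ?_).2 ⟨v, ?_, by simpa using hvu⟩
  · intro z hz
    simp only [Finset.mem_filter, Finset.mem_univ, true_and] at hz ⊢
    have hzv : z ≠ v := fun h => hvu (h ▸ hz)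
    have hzw : z ≠ w := fun h => hwu (h ▸ hz)
    rwa [Equiv.trans_apply, Equiv.swap_apply_of_ne_of_ne hzv hzw]
  · rw [Finset.mem_filter]
    exact ⟨Finset.mem_univ _, by simpa using hvw⟩

/-- The vertex `v` and its partner `π v` move together: they have the same colour `i`, and the
gaps at `i` and `i + 1` in their basket do not have opposite signs. -/
def MovesTogether {n : ℕ} (B : Fin 3 → Finset (Fin n)) (x : Config n × Config n)
    (π : Equiv.Perm (Fin n)) (v : Fin n) : Prop :=
  x.1 v = x.2 (π v) ∧ ∀ m, v ∈ B m → 0 ≤ gap (B m) x (x.1 v) * gap (B m) x (x.1 v + 1)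

/-- The basketwise coupling driven by a choice of permutations: a uniform vertex `v` is paired with
its partner; either both rotate or none (each with probability `1/2`), or exactly one of them
rotates. -/
noncomputable def basketCoupling {n : ℕ} (B : Fin 3 → Finset (Fin n))
    (π : Config n × Config n → Equiv.Perm (Fin n)) :
    Matrix (Config n × Config n) (Config n × Config n) ℝ :=
  Matrix.of fun x y => (1 / (n : ℝ)) * ∑ v : Fin n, (1 / 2) *
    (if MovesTogether B x (π x) v then
      (if y = (bump x.1 v, bump x.2 (π x v)) then (1 : ℝ) else 0) + (if y = x then 1 else 0)
    else
      (if y = (bump x.1 v, x.2) then (1 : ℝ) else 0)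
        + (if y = (x.1, bump x.2 (π x v)) then 1 else 0))

lemma basketCoupling_mulVec {n : ℕ} (B : Fin 3 → Finset (Fin n))
    (π : Config n × Config n → Equiv.Perm (Fin n)) (f : Config n × Config n → ℝ)
    (x : Config n × Config n) :
    (basketCoupling B π).mulVec f x = (1 / (n : ℝ)) * ∑ v : Fin n, (1 / 2) *
      (if MovesTogether B x (π x) v then f (bump x.1 v, bump x.2 (π x v)) + f x
      else f (bump x.1 v, x.2) + f (x.1, bump x.2 (π x v))) := by
  simp only [Matrix.mulVec, dotProduct, basketCoupling, Matrix.of_apply]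
  simp only [Finset.mul_sum, Finset.sum_mul]
  rw [Finset.sum_comm]
  refine Finset.sum_congr rfl fun v _ => ?_
  simp only [mul_assoc, ← Finset.mul_sum]
  congr 2
  split_ifs <;> simp [add_mul, Finset.sum_add_distrib]

lemma basketCoupling_mulVec_fst {n : ℕ} (B : Fin 3 → Finset (Fin n))
    (π : Config n × Config n → Equiv.Perm (Fin n)) (f : Config n → ℝ) (x : Config n × Config n) :
    (basketCoupling B π).mulVec (fun y => f y.1) x =
      (1 / (n : ℝ)) * ∑ v : Fin n, (1 / 2) * (f (bump x.1 v) + f x.1) := by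
  simp only [basketCoupling_mulVec, ite_self]

lemma basketCoupling_mulVec_snd {n : ℕ} (B : Fin 3 → Finset (Fin n))
    (π : Config n × Config n → Equiv.Perm (Fin n)) (f : Config n → ℝ) (x : Config n × Config n) :
    (basketCoupling B π).mulVec (fun y => f y.2) x =
      (1 / (n : ℝ)) * ∑ v : Fin n, (1 / 2) * (f (bump x.2 v) + f x.2) := by
  rw [basketCoupling_mulVec,
    ← Equiv.sum_comp (π x) fun v => (1 / 2 : ℝ) * (f (bump x.2 v) + f x.2)]
  refine congrArg _ (Finset.sum_congr rfl fun v _ => ?_)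
  split_ifs <;> ring

lemma basketCoupling_mulVec_one {n : ℕ} (B : Fin 3 → Finset (Fin n))
    (π : Config n × Config n → Equiv.Perm (Fin n)) (hn : 0 < n) :
    (basketCoupling B π).mulVec 1 = 1 := by
  funext x
  refine (basketCoupling_mulVec_fst B π (fun _ => 1) x).trans ?_
  norm_num [hn.ne']

lemma cyclicP_half_apply {n : ℕ} (σ τ : Config n) :
    cyclicP n (1 / 2) σ τ = (1 / (n : ℝ)) * ∑ v : Fin n, (1 / 2) *
      ((if τ = bump σ v then (1 : ℝ) else 0) + if τ = σ then 1 else 0) := by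
  rw [cyclicP, Matrix.of_apply]
  refine congrArg _ (Finset.sum_congr rfl fun v _ => ?_)
  by_cases h₁ : τ = σ <;> by_cases h₂ : τ = bump σ v <;> simp only [bump] at h₂ <;>
    simp only [h₁, h₂, bump, if_true, if_false] <;> ring

lemma basketCoupling_isCoupling {n : ℕ} (B : Fin 3 → Finset (Fin n))
    (π : Config n × Config n → Equiv.Perm (Fin n)) : IsCoupling n (1 / 2) (basketCoupling B π) := by
  refine ⟨fun x y => ?_, fun x τ => ?_, fun x τ => ?_⟩
  · simp only [basketCoupling, Matrix.of_apply]
    refine mul_nonneg (by positivity) (Finset.sum_nonneg fun v _ => ?_)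
    split_ifs <;> norm_num
  · have h := basketCoupling_mulVec_fst B π (fun ρ => if τ = ρ then 1 else 0) x
    rw [cyclicP_half_apply, ← h]
    simp only [Matrix.mulVec, dotProduct, Fintype.sum_prod_type, mul_ite, mul_one, mul_zero]
    rw [Finset.sum_comm]
    simp
  · have h := basketCoupling_mulVec_snd B π (fun ρ => if τ = ρ then 1 else 0) x
    rw [cyclicP_half_apply, ← h]
    simp [Matrix.mulVec, dotProduct, Fintype.sum_prod_type]

lemma sum_comp_eq_sum_card_mul {α ι : Type*} [Fintype ι] [DecidableEq ι] (U : Finset α)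
    (h : α → ι) (g : ι → ℝ) :
    ∑ v ∈ U, g (h v) = ∑ i, ((U.filter fun v => h v = i).card : ℝ) * g i := by
  rw [← Finset.sum_fiberwise U h]
  refine Finset.sum_congr rfl fun i _ => ?_
  rw [← nsmul_eq_mul, ← Finset.sum_const]
  exact Finset.sum_congr rfl fun v hv => by rw [(Finset.mem_filter.1 hv).2]

/-- If the gaps at `i` and `i + 1` have opposite signs, independent rotations at `i` push a concave
monotone function of the excess down. -/
lemma rotation_drift_of_mul_neg {F : ℤ → ℝ} (hF : Monotone F)
    (hF' : ∀ u, F (u + 1) - 2 * F u + F (u - 1) ≤ 0) {d : Fin 3 → ℤ} {i : Fin 3}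
    (h : d i * d (i + 1) < 0) {a b L : ℝ} (hab : a - b = d i) (ha : L ≤ a) (hb : L ≤ b) :
    a * (F (excess (rotate d i)) - F (excess d)) + b * (F (excess (unrotate d i)) - F (excess d))
      ≤ L * (F (excess d + 1) - 2 * F (excess d) + F (excess d - 1)) := by
  have hc := hF' (excess d)
  have hm : F (excess d - 1) ≤ F (excess d) := hF (by omega)
  rcases mul_neg_iff.1 h with ⟨h₁, h₂⟩ | ⟨h₁, h₂⟩
  · obtain ⟨e₁, e₂⟩ := excess_rotate_of_pos_neg h₁ h₂
    have : (0 : ℝ) < a - b := by rw [hab]; exact_mod_cast h₁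
    rw [e₁, e₂]
    nlinarith
  · obtain ⟨e₁, e₂⟩ := excess_rotate_of_neg_pos h₁ h₂
    have : a - b < (0 : ℝ) := by rw [hab]; exact_mod_cast h₁
    rw [e₁, e₂]
    nlinarith

lemma rotation_drift_of_mul_nonneg (F : ℤ → ℝ) {d : Fin 3 → ℤ} {i : Fin 3}
    (h : 0 ≤ d i * d (i + 1)) {a b : ℕ} (hab : (a : ℤ) - b = d i) (h0 : a = 0 ∨ b = 0) :
    a * (F (excess (rotate d i)) - F (excess d)) + b * (F (excess (unrotate d i)) - F (excess d))
      = 0 := by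
  rcases lt_trichotomy (d i) 0 with hd | hd | hd
  · have ha : a = 0 := by omega
    rw [excess_unrotate_of_neg_nonpos hd (by nlinarith), ha]
    simp
  · have ha : a = 0 := by omega
    have hb : b = 0 := by omega
    simp [ha, hb]
  · have hb : b = 0 := by omega
    rw [excess_rotate_of_pos_nonneg hd (by nlinarith), hb]
    simp

section Matching

variable {n : ℕ} {B : Fin 3 → Finset (Fin n)} {x : Config n × Config n} {π : Equiv.Perm (Fin n)}

lemma IsMatching.card_filter_comp (hπ : IsMatching B x π) (m i : Fin 3) :
    (((B m).filter fun v => x.2 (π v) = i).card : ℤ) = colorCount (B m) x.2 i := by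
  rw [colorCount]
  refine congrArg _ (Finset.card_bij (fun v _ => π v) ?_ ?_ ?_)
  · intro v hv
    simpa [hπ.mem_iff] using hv
  · intro v _ w _ h
    exact π.injective h
  · intro w hw
    refine ⟨π.symm w, ?_, by simp⟩
    have := hπ.mem_iff (π.symm w) m
    simp_all

/-- The vertices of basket `m` that do not move together with their partner. -/
noncomputable def unpaired (B : Fin 3 → Finset (Fin n)) (x : Config n × Config n)
    (π : Equiv.Perm (Fin n)) (m : Fin 3) : Finset (Fin n) :=
  (B m).filter fun v => ¬ MovesTogether B x π v

lemma IsMatching.card_unpaired_sub (hπ : IsMatching B x π) (m i : Fin 3) :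
    (((unpaired B x π m).filter fun v => x.1 v = i).card : ℤ)
      - ((unpaired B x π m).filter fun v => x.2 (π v) = i).card = gap (B m) x i := by
  have h : ((B m).filter fun v => x.1 v = i).filter (MovesTogether B x π)
      = ((B m).filter fun v => x.2 (π v) = i).filter (MovesTogether B x π) := by
    ext v
    simp only [Finset.mem_filter]
    constructor <;> rintro ⟨⟨h₁, h₂⟩, h₃⟩ <;> have := h₃.1 <;> simp_all
  have h₁ := Finset.card_filter_add_card_filter_not (s := (B m).filter fun v => x.1 v = i)
    (MovesTogether B x π)
  have h₂ := Finset.card_filter_add_card_filter_not (s := (B m).filter fun v => x.2 (π v) = i)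
    (MovesTogether B x π)
  rw [gap, ← hπ.card_filter_comp, colorCount, unpaired, Finset.filter_filter,
    Finset.filter_filter]
  rw [h, Finset.filter_filter, Finset.filter_filter] at h₁
  rw [Finset.filter_filter, Finset.filter_filter] at h₂
  simp only [and_comm (a := ¬ MovesTogether B x π _)]
  omega

lemma IsMatching.card_unpaired_of_mul_neg (hπ : IsMatching B x π) {m i : Fin 3}
    (h : gap (B m) x i * gap (B m) x (i + 1) < 0) :
    (((unpaired B x π m).filter fun v => x.1 v = i).card : ℤ) = colorCount (B m) x.1 i ∧
    (((unpaired B x π m).filter fun v => x.2 (π v) = i).card : ℤ) = colorCount (B m) x.2 i := by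
  have key : (unpaired B x π m).filter (fun v => x.1 v = i)
      = (B m).filter fun v => x.1 v = i := by
    ext v
    simp only [unpaired, Finset.mem_filter, and_assoc]
    refine and_congr_right fun hv => and_iff_right_of_imp fun hi ht => ?_
    have := ht.2 m hv
    rw [hi] at this
    exact this.not_gt h
  have h₁ : (((unpaired B x π m).filter fun v => x.1 v = i).card : ℤ)
      = colorCount (B m) x.1 i := by rw [key, colorCount]
  have h₂ := hπ.card_unpaired_sub m i
  rw [gap] at h₂
  exact ⟨h₁, by omega⟩

lemma IsMatching.card_unpaired_of_mul_nonneg (hB : IsPartition B) (hπ : IsMatching B x π)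
    {m i : Fin 3} (h : 0 ≤ gap (B m) x i * gap (B m) x (i + 1)) :
    ((unpaired B x π m).filter fun v => x.1 v = i).card = 0 ∨
    ((unpaired B x π m).filter fun v => x.2 (π v) = i).card = 0 := by
  by_contra! hc
  obtain ⟨v, hv⟩ := Finset.card_ne_zero.1 hc.1
  obtain ⟨w, hw⟩ := Finset.card_ne_zero.1 hc.2
  simp only [unpaired, Finset.mem_filter] at hv hw
  have aux : ∀ z ∈ B m, x.1 z = i → x.1 z = x.2 (π z) → MovesTogether B x π z := by
    refine fun z hz hi he => ⟨he, fun k hk => ?_⟩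
    have : k = m := by
      by_contra hkm
      exact Finset.disjoint_left.1 (hB.1 k m hkm) hk hz
    rwa [this, hi]
  refine hπ.maximal m v hv.1.1 w hw.1.1 (fun he => hv.1.2 (aux v hv.1.1 hv.2 he))
    (fun he => hw.1.2 (aux w hw.1.1 (he.trans hw.2) he)) (hv.2.trans hw.2.symm)

lemma IsMatching.unpaired_drift_le (hB : IsPartition B) (hπ : IsMatching B x π) {F : ℤ → ℝ}
    (hF : Monotone F) (hF' : ∀ u, F (u + 1) - 2 * F u + F (u - 1) ≤ 0) (m : Fin 3) {L : ℝ}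
    (hL0 : L = 0 ∨ excess (gap (B m) x) ≠ 0)
    (hL₁ : ∀ k, L ≤ colorCount (B m) x.1 k) (hL₂ : ∀ k, L ≤ colorCount (B m) x.2 k) :
    ∑ v ∈ unpaired B x π m,
      ((F (excess (rotate (gap (B m) x) (x.1 v))) - F (excess (gap (B m) x)))
        + (F (excess (unrotate (gap (B m) x) (x.2 (π v)))) - F (excess (gap (B m) x))))
      ≤ L * (F (excess (gap (B m) x) + 1) - 2 * F (excess (gap (B m) x))
          + F (excess (gap (B m) x) - 1)) := by
  set d := gap (B m) x with hd
  rw [Finset.sum_add_distrib,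
    sum_comp_eq_sum_card_mul _ x.1 fun i => F (excess (rotate d i)) - F (excess d),
    sum_comp_eq_sum_card_mul _ (fun v => x.2 (π v))
      fun i => F (excess (unrotate d i)) - F (excess d), ← Finset.sum_add_distrib]
  have hneg : ∀ i, d i * d (i + 1) < 0 → ∀ l : ℝ, l ≤ colorCount (B m) x.1 i →
      l ≤ colorCount (B m) x.2 i →
      (((unpaired B x π m).filter fun v => x.1 v = i).card : ℝ)
          * (F (excess (rotate d i)) - F (excess d))
        + (((unpaired B x π m).filter fun v => x.2 (π v) = i).card : ℝ)
          * (F (excess (unrotate d i)) - F (excess d))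
      ≤ l * (F (excess d + 1) - 2 * F (excess d) + F (excess d - 1)) := by
    intro i hi l h₁ h₂
    obtain ⟨e₁, e₂⟩ := hπ.card_unpaired_of_mul_neg hi
    refine rotation_drift_of_mul_neg hF hF' hi ?_ ?_ ?_
    · exact_mod_cast hπ.card_unpaired_sub m i
    · rw [← e₁] at h₁; exact_mod_cast h₁
    · rw [← e₂] at h₂; exact_mod_cast h₂
  have hnonpos : ∀ i ∈ univ, (((unpaired B x π m).filter fun v => x.1 v = i).card : ℝ)
          * (F (excess (rotate d i)) - F (excess d))
        + (((unpaired B x π m).filter fun v => x.2 (π v) = i).card : ℝ)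
          * (F (excess (unrotate d i)) - F (excess d)) ≤ 0 := by
    intro i _
    rcases lt_or_ge (d i * d (i + 1)) 0 with hi | hi
    · refine (hneg i hi 0 ?_ ?_).trans (by simp) <;> exact_mod_cast colorCount_nonneg _ _ _
    · exact (rotation_drift_of_mul_nonneg F hi (hπ.card_unpaired_sub m i)
        (hπ.card_unpaired_of_mul_nonneg hB hi)).le
  rcases hL0 with rfl | hne
  · exact (Finset.sum_nonpos hnonpos).trans_eq (zero_mul _).symm
  · obtain ⟨i, hi⟩ := exists_mul_succ_neg (sum_gap (B m) x) hne
    rw [← Finset.add_sum_erase _ _ (Finset.mem_univ i)]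
    have h₁ := hneg i hi L (hL₁ i) (hL₂ i)
    have h₂ := Finset.sum_nonpos (s := univ.erase i) fun j hj =>
      hnonpos j (Finset.mem_of_mem_erase hj)
    linarith

end Matching

/-- One-step drift of a concave monotone function of the excess in a basket. -/
lemma basketCoupling_mulVec_excess_le {n : ℕ} {B : Fin 3 → Finset (Fin n)} (hB : IsPartition B)
    {π : Config n × Config n → Equiv.Perm (Fin n)} (x : Config n × Config n)
    (hπ : IsMatching B x (π x)) (hn : 0 < n) {F : ℤ → ℝ}
    (hF : Monotone F) (hF' : ∀ u, F (u + 1) - 2 * F u + F (u - 1) ≤ 0) (m : Fin 3) {L : ℝ}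
    (hL0 : L = 0 ∨ excess (gap (B m) x) ≠ 0)
    (hL₁ : ∀ k, L ≤ colorCount (B m) x.1 k) (hL₂ : ∀ k, L ≤ colorCount (B m) x.2 k) :
    (basketCoupling B π).mulVec (fun y => F (excess (gap (B m) y))) x
      ≤ F (excess (gap (B m) x)) + L / (2 * n) * (F (excess (gap (B m) x) + 1)
          - 2 * F (excess (gap (B m) x)) + F (excess (gap (B m) x) - 1)) := by
  have key := hπ.unpaired_drift_le hB hF hF' m hL0 hL₁ hL₂
  rw [basketCoupling_mulVec]
  set d := gap (B m) x with hd
  have hterm : ∀ v, (1 / 2 : ℝ) * (if MovesTogether B x (π x) v then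
        F (excess (gap (B m) (bump x.1 v, bump x.2 (π x v)))) + F (excess d)
      else F (excess (gap (B m) (bump x.1 v, x.2)))
        + F (excess (gap (B m) (x.1, bump x.2 (π x v))))) =
      F (excess d) + (1 / 2) * if v ∈ unpaired B x (π x) m then
        (F (excess (rotate d (x.1 v))) - F (excess d))
          + (F (excess (unrotate d (x.2 (π x v)))) - F (excess d)) else 0 := by
    intro v
    have hmem := hπ.mem_iff v m
    by_cases hv : v ∈ B m
    · have hv' := hmem.2 hv
      by_cases ht : MovesTogether B x (π x) v
      · rw [if_pos ht, if_neg (by simp [unpaired, ht]), gap_bump_both x hv hv' ht.1, hd]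
        ring
      · rw [if_neg ht, if_pos (by simp [unpaired, ht, hv]), gap_bump_left x hv,
          gap_bump_right x hv', hd]
        ring
    · have hv' : π x v ∉ B m := fun h => hv (hmem.1 h)
      have e₁ := colorCount_bump_of_notMem x.1 hv
      have e₂ := colorCount_bump_of_notMem x.2 hv'
      have g₁ : gap (B m) (bump x.1 v, bump x.2 (π x v)) = d := by
        funext k; simp only [gap, e₁, e₂, hd]
      have g₂ : gap (B m) (bump x.1 v, x.2) = d := by funext k; simp only [gap, e₁, hd]
      have g₃ : gap (B m) (x.1, bump x.2 (π x v)) = d := by funext k; simp only [gap, e₂, hd]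
      rw [g₁, g₂, g₃, ite_self, if_neg (by simp [unpaired, hv])]
      ring
  rw [Finset.sum_congr rfl fun v _ => hterm v, Finset.sum_add_distrib, ← Finset.mul_sum,
    Finset.sum_ite_mem, Finset.univ_inter]
  have hn' : (0 : ℝ) < n := by exact_mod_cast hn
  simp only [Finset.sum_const, Finset.card_univ, Fintype.card_fin, nsmul_eq_mul]
  rw [mul_add, ← mul_assoc (1 / (n : ℝ)), one_div_mul_cancel hn'.ne', one_mul, ← mul_assoc]
  refine add_le_add le_rfl ((mul_le_mul_of_nonneg_left key (by positivity)).trans_eq ?_)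
  field_simp

section Hitting

variable {S : Type*} [Fintype S] [DecidableEq S] {K : Matrix S S ℝ}

lemma Matrix.pow_nonneg_of_nonneg (hK : ∀ x y, 0 ≤ K x y) (t : ℕ) (x y : S) : 0 ≤ (K ^ t) x y := by
  induction t generalizing y with
  | zero => rw [pow_zero, Matrix.one_apply]; split_ifs <;> norm_num
  | succ t ih =>
    rw [pow_succ, Matrix.mul_apply]
    exact Finset.sum_nonneg fun z _ => mul_nonneg (ih z) (hK z y)

lemma Matrix.pow_mulVec_mono (hK : ∀ x y, 0 ≤ K x y) (t : ℕ) {f g : S → ℝ} (h : ∀ y, f y ≤ g y)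
    (x : S) : (K ^ t).mulVec f x ≤ (K ^ t).mulVec g x :=
  Finset.sum_le_sum fun y _ =>
    mul_le_mul_of_nonneg_left (h y) (Matrix.pow_nonneg_of_nonneg hK t x y)

lemma Matrix.pow_mulVec_one (hK : K.mulVec 1 = 1) (t : ℕ) : (K ^ t).mulVec 1 = 1 := by
  induction t with
  | zero => simp
  | succ t ih => rw [pow_succ, ← Matrix.mulVec_mulVec, hK, ih]

/-- If `χ` is a supermartingale for the chain `K` that is dominated by `g + η w + κ V`, where `w`
decreases at rate `c g` and `V` grows at rate at most `2`, then the mean of `χ` at time `T` is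
controlled by the initial values of `w` and `V`. -/
lemma Matrix.mul_pow_mulVec_le_of_drift (hK : ∀ x y, 0 ≤ K x y) (hK1 : K.mulVec 1 = 1)
    {χ g w V : S → ℝ} {c η κ : ℝ} (hc : 0 < c) (hη : 0 ≤ η) (hκ : 0 ≤ κ)
    (hχ : ∀ x, K.mulVec χ x ≤ χ x) (hg0 : ∀ x, 0 ≤ g x) (hw0 : ∀ x, 0 ≤ w x)
    (hw : ∀ x, K.mulVec w x ≤ w x - c * g x) (hV : ∀ x, K.mulVec V x ≤ V x + 2)
    (hdom : ∀ x, χ x ≤ g x + η * w x + κ * V x) (T : ℕ) (x : S) :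
    T * (K ^ T).mulVec χ x ≤ w x / c + T * (η * w x + κ * (V x + 2 * T)) := by
  have hsucc : ∀ t (f : S → ℝ), (K ^ (t + 1)).mulVec f x = (K ^ t).mulVec (K.mulVec f) x := by
    intro t f
    rw [pow_succ, Matrix.mulVec_mulVec]
  have hnn : ∀ t (f : S → ℝ), (∀ y, 0 ≤ f y) → 0 ≤ (K ^ t).mulVec f x := fun t f hf =>
    Finset.sum_nonneg fun y _ => mul_nonneg (Matrix.pow_nonneg_of_nonneg hK t x y) (hf y)
  have hanti : Antitone fun t => (K ^ t).mulVec χ x := antitone_nat_of_succ_le fun t => by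
    rw [hsucc]
    exact Matrix.pow_mulVec_mono hK t hχ x
  have hwstep : ∀ t, (K ^ (t + 1)).mulVec w x ≤ (K ^ t).mulVec w x - c * (K ^ t).mulVec g x := by
    intro t
    rw [hsucc]
    refine (Matrix.pow_mulVec_mono hK t (g := w - c • g) (by simpa using hw) x).trans_eq ?_
    rw [Matrix.mulVec_sub, Matrix.mulVec_smul]
    simp
  have hwsum : ∀ t, c * ∑ s ∈ Finset.range t, (K ^ s).mulVec g x + (K ^ t).mulVec w x ≤ w x := by
    intro t
    induction t with
    | zero => simp
    | succ t ih =>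
      rw [Finset.sum_range_succ]
      linarith [hwstep t]
  have hwle : ∀ t, (K ^ t).mulVec w x ≤ w x := fun t => by
    have := hwsum t
    have := mul_nonneg hc.le (Finset.sum_nonneg fun s (_ : s ∈ Finset.range t) => hnn s g hg0)
    linarith
  have hVle : ∀ t : ℕ, (K ^ t).mulVec V x ≤ V x + 2 * t := by
    intro t
    induction t with
    | zero => simp
    | succ t ih =>
      have h : (K ^ (t + 1)).mulVec V x ≤ (K ^ t).mulVec V x + 2 := by
        rw [hsucc]
        refine (Matrix.pow_mulVec_mono hK t (g := V + (2 : ℝ) • 1) (by simpa using hV) x).trans_eq ?_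
        rw [Matrix.mulVec_add, Matrix.mulVec_smul, Matrix.pow_mulVec_one hK1]
        simp
      push_cast
      linarith
  have hdomt : ∀ t ∈ Finset.range T, (K ^ T).mulVec χ x
      ≤ (K ^ t).mulVec g x + (η * w x + κ * (V x + 2 * T)) := by
    intro t ht
    have htT := Finset.mem_range.1 ht
    have h₁ := hanti htT.le
    have h₂ : (K ^ t).mulVec χ x
        ≤ (K ^ t).mulVec g x + η * (K ^ t).mulVec w x + κ * (K ^ t).mulVec V x := by
      refine (Matrix.pow_mulVec_mono hK t (g := g + η • w + κ • V)
        (by simpa using hdom) x).trans_eq ?_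
      rw [Matrix.mulVec_add, Matrix.mulVec_add, Matrix.mulVec_smul, Matrix.mulVec_smul]
      simp
    have h₃ := mul_le_mul_of_nonneg_left (hwle t) hη
    have h₄ : κ * (K ^ t).mulVec V x ≤ κ * (V x + 2 * T) := by
      refine mul_le_mul_of_nonneg_left ((hVle t).trans ?_) hκ
      have : (t : ℝ) ≤ T := by exact_mod_cast htT.le
      linarith
    simp only at h₁
    linarith
  have hsum := Finset.sum_le_sum hdomt
  simp only [Finset.sum_add_distrib, Finset.sum_const, Finset.card_range, nsmul_eq_mul] at hsum
  have hgsum : ∑ s ∈ Finset.range T, (K ^ s).mulVec g x ≤ w x / c := by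
    rw [le_div_iff₀ hc]
    linarith [hwsum T, hnn T w hw0]
  simp only [mul_add] at hsum ⊢
  linarith

end Hitting

/-- Squared distance of the colour counts in `A` from the balanced vector. -/
noncomputable def imbalance {n : ℕ} (A : Finset (Fin n)) (σ : Config n) : ℝ :=
  ∑ k, ((colorCount A σ k : ℝ) - A.card / 3) ^ 2

lemma imbalance_nonneg {n : ℕ} (A : Finset (Fin n)) (σ : Config n) : 0 ≤ imbalance A σ :=
  Finset.sum_nonneg fun _ _ => sq_nonneg _

lemma imbalance_bump_of_mem {n : ℕ} {A : Finset (Fin n)} (σ : Config n) {v : Fin n} (hv : v ∈ A) :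
    imbalance A (bump σ v) = imbalance A σ
      + (2 * ((colorCount A σ (σ v + 1) : ℝ) - colorCount A σ (σ v)) + 2) := by
  simp only [imbalance, colorCount_bump_of_mem σ hv]
  generalize σ v = i
  fin_cases i <;> simp [Fin.sum_univ_three, rotate] <;> ring

lemma sum_imbalance_bump_le {n : ℕ} (A : Finset (Fin n)) (σ : Config n) :
    (1 / (n : ℝ)) * ∑ v : Fin n, (1 / 2) * (imbalance A (bump σ v) + imbalance A σ)
      ≤ imbalance A σ + 1 := by
  rcases Nat.eq_zero_or_pos n with rfl | hn
  · simpa using add_nonneg (imbalance_nonneg A σ) zero_le_one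
  have hterm : ∀ v, (1 / 2 : ℝ) * (imbalance A (bump σ v) + imbalance A σ) = imbalance A σ
      + if v ∈ A then ((colorCount A σ (σ v + 1) : ℝ) - colorCount A σ (σ v)) + 1 else 0 := by
    intro v
    split_ifs with hv
    · rw [imbalance_bump_of_mem σ hv]
      ring
    · rw [imbalance, colorCount_bump_of_notMem σ hv, ← imbalance]
      ring
  have hsum : ∑ v ∈ A, (((colorCount A σ (σ v + 1) : ℝ) - colorCount A σ (σ v)) + 1) ≤ n := by
    rw [sum_comp_eq_sum_card_mul A σ
      fun i => ((colorCount A σ (i + 1) : ℝ) - colorCount A σ i) + 1]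
    have hcard : ∀ i, ((A.filter fun v => σ v = i).card : ℝ) = colorCount A σ i := by
      simp [colorCount]
    have htot : ∑ i, (colorCount A σ i : ℝ) = A.card := by exact_mod_cast sum_colorCount A σ
    have hle : (A.card : ℝ) ≤ n := by
      exact_mod_cast (Finset.card_le_univ A).trans_eq (Fintype.card_fin n)
    simp only [hcard, Fin.sum_univ_three, zero_add, Fin.reduceAdd] at htot ⊢
    nlinarith [sq_nonneg ((colorCount A σ 0 : ℝ) - colorCount A σ 1),
      sq_nonneg ((colorCount A σ 1 : ℝ) - colorCount A σ 2),
      sq_nonneg ((colorCount A σ 2 : ℝ) - colorCount A σ 0)]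
  have hn' : (0 : ℝ) < n := by exact_mod_cast hn
  rw [Finset.sum_congr rfl fun v _ => hterm v, Finset.sum_add_distrib, Finset.sum_ite_mem,
    Finset.univ_inter, Finset.sum_const, Finset.card_univ, Fintype.card_fin, nsmul_eq_mul,
    one_div, inv_mul_le_iff₀ hn']
  linarith

/-- If the counts are not all at least a sixth of the basket, the imbalance is macroscopic. -/
lemma sq_div_le_imbalance {n : ℕ} {A : Finset (Fin n)} {σ : Config n} {k : Fin 3}
    (h : (colorCount A σ k : ℝ) < A.card / 6) : (A.card : ℝ) ^ 2 / 36 ≤ imbalance A σ := by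
  refine le_trans ?_ (Finset.single_le_sum (f := fun k => ((colorCount A σ k : ℝ) - A.card / 3) ^ 2)
    (fun _ _ => sq_nonneg _) (Finset.mem_univ k))
  have : (0 : ℝ) ≤ A.card := by positivity
  nlinarith

/-- The concave parabola `h² - ((h - u)⁺)²`. -/
noncomputable def cappedParabola (h : ℕ) (u : ℤ) : ℝ := (h : ℝ) ^ 2 - (max ((h : ℝ) - u) 0) ^ 2

lemma cappedParabola_monotone (h : ℕ) : Monotone (cappedParabola h) := by
  intro u v huv
  have : (u : ℝ) ≤ v := by exact_mod_cast huv
  simp only [cappedParabola]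
  gcongr

lemma cappedParabola_concave (h : ℕ) (u : ℤ) :
    cappedParabola h (u + 1) - 2 * cappedParabola h u + cappedParabola h (u - 1) ≤ 0 := by
  simp only [cappedParabola]
  push_cast
  rcases le_total ((h : ℝ) - u) 0 with h₀ | h₀
  · rw [max_eq_right h₀, max_eq_right (by linarith : (h : ℝ) - (u + 1) ≤ 0)]
    nlinarith [sq_nonneg (max ((h : ℝ) - (u - 1)) 0)]
  · rw [max_eq_left h₀, max_eq_left (by linarith : 0 ≤ (h : ℝ) - (u - 1))]
    rcases le_total ((h : ℝ) - (u + 1)) 0 with h₁ | h₁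
    · rw [max_eq_right h₁]
      nlinarith
    · rw [max_eq_left h₁]
      nlinarith

lemma cappedParabola_second_difference {h : ℕ} {u : ℤ} (hu : u < h) :
    cappedParabola h (u + 1) - 2 * cappedParabola h u + cappedParabola h (u - 1) = -2 := by
  have : (u : ℝ) + 1 ≤ h := by exact_mod_cast hu
  simp only [cappedParabola]
  push_cast
  rw [max_eq_left (by linarith), max_eq_left (by linarith), max_eq_left (by linarith)]
  ring

lemma cappedParabola_nonneg (h : ℕ) {u : ℤ} (hu : 0 ≤ u) : 0 ≤ cappedParabola h u := by
  have := cappedParabola_monotone h hu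
  simpa [cappedParabola] using this

lemma cappedParabola_of_le {h : ℕ} {u : ℤ} (hu : (h : ℤ) ≤ u) :
    cappedParabola h u = (h : ℝ) ^ 2 := by
  have : (h : ℝ) ≤ u := by exact_mod_cast hu
  rw [cappedParabola, max_eq_right (by linarith)]
  ring

lemma cappedParabola_le (h : ℕ) {u : ℤ} (hu : 0 ≤ u) : cappedParabola h u ≤ 2 * h * u := by
  have hu' : (0 : ℝ) ≤ u := by exact_mod_cast hu
  rw [cappedParabola]
  rcases le_total ((h : ℝ) - u) 0 with h₀ | h₀
  · rw [max_eq_right h₀]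
    nlinarith [Nat.cast_nonneg (α := ℝ) h]
  · rw [max_eq_left h₀]
    nlinarith

/-- Quantitative coalescence of a single basket. -/
lemma mul_pow_basketCoupling_mulVec_le {n : ℕ} {B : Fin 3 → Finset (Fin n)} (hB : IsPartition B)
    {π : Config n × Config n → Equiv.Perm (Fin n)} (hπ : ∀ x, IsMatching B x (π x)) (hn : 0 < n)
    {lam : ℝ} (hlam : 0 < lam) (m : Fin 3) (hm : lam * n < (B m).card) {h : ℕ} (hh : 0 < h)
    (T : ℕ) (x : Config n × Config n) :
    T * ((basketCoupling B π) ^ T).mulVec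
        (fun y => ((min (excess (gap (B m) y)) 1 : ℤ) : ℝ)) x
      ≤ 2 * h * excess (gap (B m) x) / (lam / 6)
        + T * (1 / (h : ℝ) ^ 2 * (2 * h * excess (gap (B m) x))
          + 36 / ((B m).card : ℝ) ^ 2 * (imbalance (B m) x.1 + imbalance (B m) x.2 + 2 * T)) := by
  have hn' : (0 : ℝ) < n := by exact_mod_cast hn
  have hh' : (0 : ℝ) < h := by exact_mod_cast hh
  have hN : (0 : ℝ) < (B m).card := lt_trans (by positivity) hm
  have hK := basketCoupling_isCoupling B π
  have hK1 := basketCoupling_mulVec_one B π hn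
  set good : Config n × Config n → Prop := fun y =>
    0 < excess (gap (B m) y) ∧ excess (gap (B m) y) < h ∧
      (∀ k, ((B m).card : ℝ) / 6 ≤ colorCount (B m) y.1 k) ∧
      ∀ k, ((B m).card : ℝ) / 6 ≤ colorCount (B m) y.2 k with hgood
  have hwle : cappedParabola h (excess (gap (B m) x)) ≤ 2 * h * excess (gap (B m) x) :=
    cappedParabola_le h (excess_nonneg _)
  refine (Matrix.mul_pow_mulVec_le_of_drift hK.1 hK1 (c := lam / 6) (η := 1 / (h : ℝ) ^ 2)
    (κ := 36 / ((B m).card : ℝ) ^ 2)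
    (g := fun y => if good y then 1 else 0)
    (w := fun y => cappedParabola h (excess (gap (B m) y)))
    (V := fun y => imbalance (B m) y.1 + imbalance (B m) y.2)
    (by positivity) (by positivity) (by positivity) ?_ ?_ ?_ ?_ ?_ ?_ T x).trans ?_
  · intro y
    refine (basketCoupling_mulVec_excess_le hB y (hπ y) hn
      (F := fun u => ((min u 1 : ℤ) : ℝ)) ?_ ?_ m (Or.inl rfl) ?_ ?_).trans ?_
    · intro u v huv
      simp only
      exact_mod_cast min_le_min_right 1 huv
    · intro u
      have : min (u + 1) 1 - 2 * min u 1 + min (u - 1) 1 ≤ 0 := by omega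
      exact_mod_cast this
    · exact fun k => by exact_mod_cast colorCount_nonneg _ _ _
    · exact fun k => by exact_mod_cast colorCount_nonneg _ _ _
    · simp
  · intro y
    positivity
  · exact fun y => cappedParabola_nonneg h (excess_nonneg _)
  · intro y
    by_cases hy : good y
    · refine (basketCoupling_mulVec_excess_le hB y (hπ y) hn (cappedParabola_monotone h)
        (cappedParabola_concave h) m (Or.inr hy.1.ne') hy.2.2.1
        hy.2.2.2).trans ?_
      rw [cappedParabola_second_difference hy.2.1, if_pos hy]
      have : lam / 6 ≤ (B m).card / 6 / (2 * n) * 2 := by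
        rw [div_div, div_mul_eq_mul_div, div_le_div_iff₀ (by norm_num) (by positivity)]
        nlinarith
      linarith
    · refine (basketCoupling_mulVec_excess_le hB y (hπ y) hn (cappedParabola_monotone h)
        (cappedParabola_concave h) m (Or.inl rfl) ?_ ?_).trans ?_
      · exact fun k => by exact_mod_cast colorCount_nonneg _ _ _
      · exact fun k => by exact_mod_cast colorCount_nonneg _ _ _
      · simp [hy]
  · intro y
    have h₁ := basketCoupling_mulVec_fst B π (imbalance (B m)) y
    have h₂ := basketCoupling_mulVec_snd B π (imbalance (B m)) y
    have e : (fun z : Config n × Config n => imbalance (B m) z.1 + imbalance (B m) z.2)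
      = (fun z => imbalance (B m) z.1) + fun z => imbalance (B m) z.2 := rfl
    rw [e, Matrix.mulVec_add, Pi.add_apply, h₁, h₂]
    linarith [sum_imbalance_bump_le (B m) y.1, sum_imbalance_bump_le (B m) y.2]
  · intro y
    have hw0 := cappedParabola_nonneg h (excess_nonneg (gap (B m) y))
    have hV₁ := imbalance_nonneg (B m) y.1
    have hV₂ := imbalance_nonneg (B m) y.2
    have hχ : ((min (excess (gap (B m) y)) 1 : ℤ) : ℝ) ≤ 1 := by exact_mod_cast min_le_right _ _
    have a₁ : 0 ≤ 1 / (h : ℝ) ^ 2 * cappedParabola h (excess (gap (B m) y)) := by positivity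
    have a₂ : 0 ≤ 36 / ((B m).card : ℝ) ^ 2 * (imbalance (B m) y.1 + imbalance (B m) y.2) := by
      positivity
    have hbad : ((B m).card : ℝ) ^ 2 / 36 ≤ imbalance (B m) y.1 + imbalance (B m) y.2 →
        1 ≤ 36 / ((B m).card : ℝ) ^ 2 * (imbalance (B m) y.1 + imbalance (B m) y.2) := by
      intro hle
      rw [div_mul_eq_mul_div, le_div_iff₀ (by positivity)]
      linarith
    by_cases hy : good y
    · simp only [if_pos hy]
      linarith
    simp only [if_neg hy, zero_add]
    by_cases h0 : excess (gap (B m) y) = 0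
    · rw [h0] at a₁ ⊢
      simp only [zero_le_one, min_eq_left, Int.cast_zero]
      linarith
    by_cases hbig : (h : ℤ) ≤ excess (gap (B m) y)
    · rw [cappedParabola_of_le hbig, one_div_mul_cancel (by positivity)]
      linarith
    by_cases hl : ∀ k, ((B m).card : ℝ) / 6 ≤ colorCount (B m) y.1 k
    · by_cases hr : ∀ k, ((B m).card : ℝ) / 6 ≤ colorCount (B m) y.2 k
      · exact (hy ⟨lt_of_le_of_ne (excess_nonneg _) (Ne.symm h0), not_le.1 hbig, hl, hr⟩).elim
      · push Not at hr
        obtain ⟨k, hk⟩ := hr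
        linarith [hbad (by linarith [sq_div_le_imbalance hk])]
    · push Not at hl
      obtain ⟨k, hk⟩ := hl
      linarith [hbad (by linarith [sq_div_le_imbalance hk])]
  · gcongr

lemma abs_colorCount_sub_lt {n : ℕ} {B : Fin 3 → Finset (Fin n)} {σ : Config n} {ρ : ℝ}
    (h : inSmat ρ (basketS B σ)) {m : Fin 3} (hm : (0 : ℝ) < (B m).card) (k : Fin 3) :
    |(colorCount (B m) σ k : ℝ) - (B m).card / 3| < (B m).card * ρ := by
  have hk := (h m).2.2 k
  have e : (colorCount (B m) σ k : ℝ) - (B m).card / 3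
      = (B m).card * (basketS B σ m k - 1 / 3) := by
    simp only [basketS, colorCount, Int.cast_natCast]
    field_simp
  rw [e, abs_mul, abs_of_pos hm]
  exact mul_lt_mul_of_pos_left hk hm

lemma imbalance_le {n : ℕ} {B : Fin 3 → Finset (Fin n)} {σ : Config n} {ρ : ℝ}
    (h : inSmat ρ (basketS B σ)) {m : Fin 3} (hm : (0 : ℝ) < (B m).card) :
    imbalance (B m) σ ≤ 3 * ((B m).card * ρ) ^ 2 := by
  rw [imbalance]
  refine (Finset.sum_le_card_nsmul _ _ (((B m).card * ρ) ^ 2) fun k _ => ?_).trans_eq (by simp)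
  exact sq_le_sq.2 ((abs_colorCount_sub_lt h hm k).le.trans (le_abs_self _))

lemma excess_gap_le {n : ℕ} {B : Fin 3 → Finset (Fin n)} {x : Config n × Config n} {ρ : ℝ}
    (h₁ : inSmat ρ (basketS B x.1)) (h₂ : inSmat ρ (basketS B x.2)) {m : Fin 3}
    (hm : (0 : ℝ) < (B m).card) :
    (excess (gap (B m) x) : ℝ) ≤ 6 * ((B m).card * ρ) := by
  rw [excess]
  push_cast
  refine (Finset.sum_le_card_nsmul _ _ (2 * ((B m).card * ρ)) fun k _ => ?_).trans_eq
    (by simp; ring)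
  have a := abs_lt.1 (abs_colorCount_sub_lt h₁ hm k)
  have b := abs_lt.1 (abs_colorCount_sub_lt h₂ hm k)
  simp only [gap]
  push_cast
  exact max_le (by linarith) (by linarith)

lemma basketS_eq_of_excess_eq_zero {n : ℕ} {B : Fin 3 → Finset (Fin n)}
    {x : Config n × Config n} (h : ∀ m, excess (gap (B m) x) = 0) :
    basketS B x.1 = basketS B x.2 := by
  funext m k
  have := congrFun (eq_zero_of_excess_eq_zero (sum_gap (B m) x) (h m)) k
  simp only [gap, colorCount, Pi.zero_apply, sub_eq_zero, Nat.cast_inj] at this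
  rw [basketS, basketS, this]

/-- Union bound over the baskets for the probability of coalescence. -/
lemma one_sub_le_sum_coalesced {n : ℕ} {B : Fin 3 → Finset (Fin n)}
    {K : Matrix (Config n × Config n) (Config n × Config n) ℝ} (hK : ∀ x y, 0 ≤ K x y)
    (hK1 : K.mulVec 1 = 1) (T : ℕ) (x : Config n × Config n) :
    1 - ∑ m, (K ^ T).mulVec (fun y => ((min (excess (gap (B m) y)) 1 : ℤ) : ℝ)) x
      ≤ ∑ y : Config n × Config n,
          if basketS B y.1 = basketS B y.2 then (K ^ T) x y else 0 := by
  have h1 : ∑ y, (K ^ T) x y = 1 := by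
    simpa [Matrix.mulVec, dotProduct] using congrFun (Matrix.pow_mulVec_one hK1 T) x
  simp only [Matrix.mulVec, dotProduct]
  rw [Finset.sum_comm, ← h1, ← Finset.sum_sub_distrib]
  refine Finset.sum_le_sum fun y _ => ?_
  have hp := Matrix.pow_nonneg_of_nonneg hK T x y
  have hnn : ∀ m ∈ univ, 0 ≤ (K ^ T) x y * ((min (excess (gap (B m) y)) 1 : ℤ) : ℝ) := fun m _ =>
    mul_nonneg hp (by exact_mod_cast le_min (excess_nonneg _) zero_le_one)
  split_ifs with hy
  · linarith [Finset.sum_nonneg hnn]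
  · obtain ⟨m, hm⟩ : ∃ m, excess (gap (B m) y) ≠ 0 := by
      by_contra! hc
      exact hy (basketS_eq_of_excess_eq_zero hc)
    have h2 := Finset.single_le_sum hnn (Finset.mem_univ m)
    have h3 : min (excess (gap (B m) y)) 1 = 1 := by
      have := excess_nonneg (gap (B m) y)
      omega
    rw [h3] at h2
    simp only [Int.cast_one, mul_one] at h2
    linarith

/-- coalescence of basket chains. If `S_0 = S̃_0` and both initial
basket chains lie in `𝕊^{r/√n}`, then for every `ε > 0` there is `γ > 0` such that,
for all large `n`, some Markovian coupling (the basketwise coupling) makes the two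
basket chains coincide at time `⌈γn⌉` with probability at least `1 − ε`. -/
theorem basket_chains_coalesce (lam r ε : ℝ)
    (hlam : 0 < lam) (hr : 0 < r) (hε : 0 < ε) :
    ∃ γ : ℝ, 0 < γ ∧ ∃ N : ℕ, ∀ n : ℕ, N ≤ n →
      ∀ B : Fin 3 → Finset (Fin n),
        IsPartition B → (∀ m : Fin 3, lam * n < ((B m).card : ℝ)) →
        ∀ σ0 σ0' : Config n, propVec σ0 = propVec σ0' →
          inSmat (r / Real.sqrt n) (basketS B σ0) →
          inSmat (r / Real.sqrt n) (basketS B σ0') →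
          ∃ K : Matrix (Config n × Config n) (Config n × Config n) ℝ,
            IsCoupling n (1/2) K ∧
            1 - ε ≤ ∑ y : Config n × Config n,
              if basketS B y.1 = basketS B y.2 then (K ^ ⌈γ * n⌉₊) (σ0, σ0') y else 0 := by
  set M : ℝ := 108 * r / ε with hM
  have hMpos : 0 < M := by positivity
  set γ : ℝ := 648 * (M + 1) * r / (lam * ε) with hγ
  have hγpos : 0 < γ := by positivity
  refine ⟨γ, hγpos, ⌈9 * (216 * r ^ 2 + 72 * (γ + 1) / lam ^ 2) / ε⌉₊ + 1, fun n hnN B hB hcard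
    σ σ' _ hσ hσ' => ?_⟩
  have hn : 0 < n := by omega
  have hn1 : (1 : ℝ) ≤ n := by exact_mod_cast hn
  have hn' : (0 : ℝ) < n := by linarith
  have hnbig : 9 * (216 * r ^ 2 + 72 * (γ + 1) / lam ^ 2) / ε ≤ n :=
    (Nat.le_ceil _).trans (by exact_mod_cast (by omega))
  choose π hπ using exists_isMatching hB
  have hK := basketCoupling_isCoupling B π
  have hK1 := basketCoupling_mulVec_one B π hn
  refine ⟨basketCoupling B π, hK, le_trans ?_ (one_sub_le_sum_coalesced hK.1 hK1 _ _)⟩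
  set T := ⌈γ * n⌉₊ with hT
  have hTlo : γ * n ≤ T := Nat.le_ceil _
  have hThi : (T : ℝ) ≤ (γ + 1) * n := by
    have := Nat.ceil_lt_add_one (a := γ * n) (by positivity)
    linarith
  have hTpos : (0 : ℝ) < T := lt_of_lt_of_le (by positivity) hTlo
  set s := Real.sqrt n with hs
  have hs2 : s * s = n := Real.mul_self_sqrt hn'.le
  have hs1 : 1 ≤ s := Real.one_le_sqrt.2 hn1
  have hspos : 0 < s := by linarith
  set h := ⌈M * s⌉₊ with hh
  have hhlo : M * s ≤ h := Nat.le_ceil _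
  have hhhi : (h : ℝ) ≤ (M + 1) * s := by
    have := Nat.ceil_lt_add_one (a := M * s) (by positivity)
    linarith
  have hhpos : (0 : ℝ) < h := lt_of_lt_of_le (by positivity) hhlo
  suffices hsuff : ∀ m, ((basketCoupling B π) ^ T).mulVec
      (fun y => ((min (excess (gap (B m) y)) 1 : ℤ) : ℝ)) (σ, σ') ≤ ε / 3 by
    have := Finset.sum_le_card_nsmul univ _ _ fun m _ => hsuff m
    simp only [Finset.card_univ, Fintype.card_fin, nsmul_eq_mul, Nat.cast_ofNat] at this
    linarith
  intro m
  have hN : (0 : ℝ) < (B m).card := lt_trans (by positivity) (hcard m)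
  have hNn : ((B m).card : ℝ) ≤ n := by
    exact_mod_cast (Finset.card_le_univ (B m)).trans_eq (Fintype.card_fin n)
  have hu := excess_gap_le (x := (σ, σ')) hσ hσ' hN
  have hV₁ := imbalance_le hσ hN
  have hV₂ := imbalance_le hσ' hN
  have hmain := mul_pow_basketCoupling_mulVec_le hB hπ hn hlam m (hcard m)
    (h := h) (by exact_mod_cast hhpos) T (σ, σ')
  set u : ℝ := (excess (gap (B m) (σ, σ')) : ℝ) with hudef
  have hu0 : 0 ≤ u := Int.cast_nonneg (excess_nonneg _)
  have hus : u ≤ 6 * r * s := by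
    refine hu.trans ?_
    have : ((B m).card : ℝ) * (r / s) ≤ n * (r / s) := by gcongr
    rw [← hs2] at this
    have e : s * s * (r / s) = r * s := by field_simp
    linarith
  refine le_of_mul_le_mul_left (hmain.trans ?_) hTpos
  have b₁ : 2 * h * u / (lam / 6) ≤ T * (ε / 9) := by
    have h₁ : 2 * h * u ≤ 2 * ((M + 1) * s) * (6 * r * s) := by gcongr
    have h₂ : γ * n * (ε / 9) = 2 * ((M + 1) * s) * (6 * r * s) / (lam / 6) := by
      rw [← hs2, hγ]
      field_simp
      ring
    calc 2 * h * u / (lam / 6) ≤ 2 * ((M + 1) * s) * (6 * r * s) / (lam / 6) := by gcongr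
      _ = γ * n * (ε / 9) := h₂.symm
      _ ≤ T * (ε / 9) := by gcongr
  have b₂ : 1 / (h : ℝ) ^ 2 * (2 * h * u) ≤ ε / 9 := by
    have e : 1 / (h : ℝ) ^ 2 * (2 * h * u) = 2 * u / h := by field_simp
    rw [e, div_le_iff₀ hhpos]
    have : ε / 9 * (M * s) ≤ ε / 9 * h := by gcongr
    have e' : ε / 9 * (M * s) = 2 * (6 * r * s) := by
      rw [hM]
      field_simp
      ring
    linarith
  have b₃ : 36 / ((B m).card : ℝ) ^ 2 * (imbalance (B m) σ + imbalance (B m) σ' + 2 * T)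
      ≤ ε / 9 := by
    have h₁ : imbalance (B m) σ + imbalance (B m) σ' + 2 * T
        ≤ 6 * ((B m).card * (r / s)) ^ 2 + 2 * ((γ + 1) * n) := by linarith
    have h₂ : 36 / ((B m).card : ℝ) ^ 2 * (6 * ((B m).card * (r / s)) ^ 2) = 216 * r ^ 2 / n := by
      rw [← hs2]
      field_simp
      ring
    have h₃ : 36 / ((B m).card : ℝ) ^ 2 * (2 * ((γ + 1) * n))
        ≤ 36 / (lam * n) ^ 2 * (2 * ((γ + 1) * n)) := by
      have := (hcard m).le
      gcongr
    have h₄ : 36 / (lam * n) ^ 2 * (2 * ((γ + 1) * n)) = 72 * (γ + 1) / lam ^ 2 / n := by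
      field_simp
      ring
    have h₅ : (216 * r ^ 2 + 72 * (γ + 1) / lam ^ 2) / n ≤ ε / 9 := by
      rw [div_le_iff₀ hε] at hnbig
      rw [div_le_iff₀ hn']
      linarith
    calc 36 / ((B m).card : ℝ) ^ 2 * (imbalance (B m) σ + imbalance (B m) σ' + 2 * T)
        ≤ 36 / ((B m).card : ℝ) ^ 2 *
            (6 * ((B m).card * (r / s)) ^ 2 + 2 * ((γ + 1) * n)) := by gcongr
      _ ≤ 216 * r ^ 2 / n + 72 * (γ + 1) / lam ^ 2 / n := by
          rw [mul_add, h₂]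
          linarith
      _ ≤ ε / 9 := by rwa [← add_div]
  have b₄ : (T : ℝ) * (1 / (h : ℝ) ^ 2 * (2 * h * u)
      + 36 / ((B m).card : ℝ) ^ 2 * (imbalance (B m) σ + imbalance (B m) σ' + 2 * T))
      ≤ T * (ε / 9 + ε / 9) := by gcongr
  linarith
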